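/- arXiv:2311.06514 — 2 statements merged into one kernel-verified Lean document; each statement's English description precedes it below -/
import Mathlib

section
/- The class of data languages accepted by SAFA is not closed under Kleene star. Specifically, over Σ = {a}: the language L1 = { (a,d)(a,d) : d ∈ D } of two-letter data words consisting of the same data value repeated twice is accepted by a (deterministic) SAFA, but its Kleene closure L1* — the set of all data words that are concatenations of such pairs — is not accepted by any SAFA. -/
/-- A condition tested by a SAFA transition: membership (`pos h` = `p(h)`)
or non-membership (`neg h` = `!p(h)`) of the current data value in set `h`. -/
inductive SafaCond (H : Type) : Type
  | pos (h : H)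
  | neg (h : H)

/-- The set name a condition refers to. -/
def SafaCond.name {H : Type} : SafaCond H → H
  | .pos h => h
  | .neg h => h

/-- An operation of a SAFA transition: do nothing (`−`) or insert the
current data value into set `h` (`ins(h)`). -/
inductive SafaOp (H : Type) : Type
  | noop
  | ins (h : H)

/-- Whether a condition holds for data value `d` given set contents `s`. -/
def SafaCond.holds {H D : Type} : SafaCond H → D → (H → Set D) → Prop
  | .pos h, d, s => d ∈ s h
  | .neg h, d, s => d ∉ s h

/-- The effect of an operation on the set contents, reading data value `d`. -/
def SafaOp.apply {H D : Type} : SafaOp H → D → (H → Set D) → (H → Set D)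
  | .noop, _, s => s
  | .ins h, d, s => fun j => s j ∪ {x | j = h ∧ x = d}

/-- A transition of a SAFA: source state, attribute, condition, operation, target state. -/
structure SafaTrans (Q A H : Type) : Type where
  src : Q
  attr : A
  cond : SafaCond H
  op : SafaOp H
  dst : Q

/-- A set augmented finite automaton over attributes `A` and data values `D`:
a finite set of states `Q` with initial state `q0` and final states `F`,
a finite collection `H` of set names, and a transition relation `δ`. -/
structure SAFA (A D : Type) : Type 1 where
  Q : Type
  fintypeQ : Fintype Q
  q0 : Q
  F : Set Q
  H : Type
  fintypeH : Fintype H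
  δ : Set (SafaTrans Q A H)

attribute [instance] SAFA.fintypeQ SAFA.fintypeH

namespace SAFA

variable {A D : Type}

/-- A configuration: a state together with the current contents of the sets. -/
abbrev Config (M : SAFA A D) : Type := M.Q × (M.H → Set D)

/-- The initial configuration: initial state, all sets empty. -/
def init (M : SAFA A D) : M.Config := (M.q0, fun _ => ∅)

/-- One step: from configuration `c`, taking transition `t` while reading letter `ad`,
reaching configuration `c'`. -/
def StepVia (M : SAFA A D) (c : M.Config) (t : SafaTrans M.Q A M.H)
    (ad : A × D) (c' : M.Config) : Prop :=
  t ∈ M.δ ∧ t.src = c.1 ∧ t.attr = ad.1 ∧ t.dst = c'.1 ∧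
    t.cond.holds ad.2 c.2 ∧ c'.2 = t.op.apply ad.2 c.2

/-- Execution of a sequence of transitions `T` reading the data word `w`,
from configuration `c` to configuration `c'`. -/
inductive ExecFrom (M : SAFA A D) :
    M.Config → List (SafaTrans M.Q A M.H) → List (A × D) → M.Config → Prop
  | nil (c : M.Config) : ExecFrom M c [] [] c
  | cons {c c' c'' : M.Config} {t : SafaTrans M.Q A M.H}
      {ts : List (SafaTrans M.Q A M.H)} {ad : A × D} {w : List (A × D)} :
      M.StepVia c t ad c' → ExecFrom M c' ts w c'' → ExecFrom M c (t :: ts) (ad :: w) c''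

/-- Acceptance: some run from the initial configuration consumes all of `w`
and ends in a final state. -/
def Accepts (M : SAFA A D) (w : List (A × D)) : Prop :=
  ∃ T c, M.ExecFrom M.init T w c ∧ c.1 ∈ M.F

/-- The data language accepted by `M`. -/
def Lang (M : SAFA A D) : Set (List (A × D)) := {w | M.Accepts w}

/-- A SAFA is deterministic if, for every state and attribute, all outgoing
transitions test membership in one and the same set, with at most one transition
per polarity of the condition. -/
def IsDeterministic (M : SAFA A D) : Prop :=
  ∀ t1 t2 : SafaTrans M.Q A M.H, t1 ∈ M.δ → t2 ∈ M.δ →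
    t1.src = t2.src → t1.attr = t2.attr →
    t1.cond.name = t2.cond.name ∧ (t1.cond = t2.cond → t1 = t2)

end SAFA

/-- The language { (a,d)(a,d) : d ∈ D } over the one-letter alphabet. -/
def pairLang (D : Type) : Set (List (Unit × D)) :=
  {w | ∃ d : D, w = [((), d), ((), d)]}

/-- Kleene star of a language of data words. -/
def starLang {α : Type} (L : Set (List α)) : Set (List α) :=
  {w | ∃ ws : List (List α), (∀ u ∈ ws, u ∈ L) ∧ w = ws.flatten}

namespace SafaOp

variable {H D : Type}

theorem le_apply (op : SafaOp H) (d : D) (s : H → Set D) : s ≤ op.apply d s := by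
  cases op with
  | noop => exact le_rfl
  | ins h => exact fun _ => Set.subset_union_left

/-- An operation that does not change which sets contain the data value read leaves all sets
unchanged, and so it does for any data value lying in the same sets. -/
theorem apply_eq_self {op : SafaOp H} {d e : D} {s : H → Set D}
    (hd : ∀ h, d ∈ op.apply d s h → d ∈ s h) (he : ∀ h, d ∈ s h ↔ e ∈ s h) :
    op.apply e s = s := by
  cases op with
  | noop => rfl
  | ins h =>
    have hmem : e ∈ s h := (he h).1 (hd h (Or.inr ⟨rfl, rfl⟩))
    funext j
    refine Set.union_eq_self_of_subset_right ?_
    rintro x ⟨rfl, rfl⟩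
    exact hmem

end SafaOp

theorem SafaCond.holds_congr {H D : Type} (c : SafaCond H) {d e : D} {s : H → Set D}
    (he : ∀ h, d ∈ s h ↔ e ∈ s h) : c.holds d s ↔ c.holds e s := by
  cases c with
  | pos h => exact he h
  | neg h => exact not_congr (he h)

namespace SAFA

variable {A D : Type} {M : SAFA A D}

/-- Some run of `M` reading `w` leads from `c` to `c'`. -/
def Reach (M : SAFA A D) (c : M.Config) (w : List (A × D)) (c' : M.Config) : Prop :=
  ∃ T, M.ExecFrom c T w c'

theorem reach_nil_iff {c c' : M.Config} : M.Reach c [] c' ↔ c = c' := by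
  constructor
  · rintro ⟨T, h⟩
    cases h
    rfl
  · rintro rfl
    exact ⟨[], .nil c⟩

theorem reach_cons_iff {c c' : M.Config} {x : A × D} {w : List (A × D)} :
    M.Reach c (x :: w) c' ↔ ∃ t c₁, M.StepVia c t x c₁ ∧ M.Reach c₁ w c' := by
  constructor
  · rintro ⟨T, h⟩
    cases h with
    | cons hs he => exact ⟨_, _, hs, _, he⟩
  · rintro ⟨t, c₁, hs, T, he⟩
    exact ⟨_, .cons hs he⟩

theorem reach_append_iff {c c' : M.Config} {u v : List (A × D)} :
    M.Reach c (u ++ v) c' ↔ ∃ c₁, M.Reach c u c₁ ∧ M.Reach c₁ v c' := by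
  induction u generalizing c with
  | nil => simp [reach_nil_iff]
  | cons x u ih =>
    simp only [List.cons_append, reach_cons_iff, ih]
    constructor
    · rintro ⟨t, c₁, hs, c₂, h₁, h₂⟩
      exact ⟨c₂, ⟨t, c₁, hs, h₁⟩, h₂⟩
    · rintro ⟨c₂, ⟨t, c₁, hs, h₁⟩, h₂⟩
      exact ⟨t, c₁, hs, c₂, h₁, h₂⟩

theorem mem_lang_iff {w : List (A × D)} : w ∈ M.Lang ↔ ∃ c, M.Reach M.init w c ∧ c.1 ∈ M.F := by
  constructor
  · rintro ⟨T, c, h, hF⟩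
    exact ⟨c, ⟨T, h⟩, hF⟩
  · rintro ⟨c, ⟨T, h⟩, hF⟩
    exact ⟨T, c, h, hF⟩

theorem StepVia.le {c c' : M.Config} {t : SafaTrans M.Q A M.H} {x : A × D}
    (h : M.StepVia c t x c') : c.2 ≤ c'.2 := by
  rw [h.2.2.2.2.2]
  exact t.op.le_apply _ _

theorem Reach.le {c c' : M.Config} {w : List (A × D)} (h : M.Reach c w c') : c.2 ≤ c'.2 := by
  induction w generalizing c with
  | nil =>
    obtain rfl := reach_nil_iff.1 h
    exact le_rfl
  | cons x w ih =>
    obtain ⟨t, c₁, hs, hr⟩ := reach_cons_iff.1 h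
    exact hs.le.trans (ih hr)

/-- A step that does not change the membership of the value read can read any value
lying in the same sets instead. -/
theorem StepVia.replace {c c' : M.Config} {t : SafaTrans M.Q A M.H} {a : A} {d e : D}
    (h : M.StepVia c t (a, d) c') (hd : ∀ i, d ∈ c'.2 i → d ∈ c.2 i)
    (he : ∀ i, d ∈ c.2 i ↔ e ∈ c.2 i) : M.StepVia c t (a, e) c' := by
  obtain ⟨h₁, h₂, h₃, h₄, h₅, h₆⟩ := h
  rw [h₆] at hd
  refine ⟨h₁, h₂, h₃, h₄, (t.cond.holds_congr he).1 h₅, ?_⟩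
  rw [h₆]
  exact (SafaOp.apply_eq_self hd fun _ => Iff.rfl).trans (SafaOp.apply_eq_self hd he).symm

open Classical in
/-- The pairs of a set name and a value of `E` missing from that set. -/
noncomputable def missing (M : SAFA A D) (E : Finset D) (c : M.Config) : Finset (M.H × D) :=
  (Finset.univ ×ˢ E).filter fun p => p.2 ∉ c.2 p.1

theorem mem_missing {E : Finset D} {c : M.Config} {p : M.H × D} :
    p ∈ M.missing E c ↔ p.2 ∈ E ∧ p.2 ∉ c.2 p.1 := by
  simp [missing]

theorem missing_ssubset {E : Finset D} {c c' : M.Config} (hle : c.2 ≤ c'.2)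
    (hne : ¬ ∀ d ∈ E, ∀ i, d ∈ c'.2 i → d ∈ c.2 i) : M.missing E c' ⊂ M.missing E c := by
  push Not at hne
  obtain ⟨d, hd, i, h₁, h₂⟩ := hne
  rw [Finset.ssubset_iff_of_subset]
  · exact ⟨(i, d), mem_missing.2 ⟨hd, h₂⟩, fun h => (mem_missing.1 h).2 h₁⟩
  · intro p hp
    rw [mem_missing] at hp ⊢
    exact ⟨hp.1, fun h => hp.2 (hle _ h)⟩

/-- A run reading a word often enough reads it once without changing the memberships
of the values in a given finite set. -/
theorem Reach.exists_stable {E : Finset D} {w : List (A × D)} {N : ℕ} {c c' : M.Config}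
    (hN : (M.missing E c).card < N) (h : M.Reach c (List.replicate N w).flatten c') :
    ∃ a b c₁ c₂, N = a + 1 + b ∧ M.Reach c (List.replicate a w).flatten c₁ ∧ M.Reach c₁ w c₂ ∧
      M.Reach c₂ (List.replicate b w).flatten c' ∧ ∀ d ∈ E, ∀ i, d ∈ c₂.2 i → d ∈ c₁.2 i := by
  induction N generalizing c with
  | zero => omega
  | succ N ih =>
    rw [List.replicate_succ, List.flatten_cons, reach_append_iff] at h
    obtain ⟨c₀, h₀, h⟩ := h
    by_cases hst : ∀ d ∈ E, ∀ i, d ∈ c₀.2 i → d ∈ c.2 i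
    · exact ⟨0, N, c, c₀, by omega, reach_nil_iff.2 rfl, h₀, h, hst⟩
    · have hlt := Finset.card_lt_card (missing_ssubset h₀.le hst)
      obtain ⟨a, b, c₁, c₂, hab, h₁, h₂, h₃, h₄⟩ := ih (by omega) h
      refine ⟨a + 1, b, c₁, c₂, by omega, ?_, h₂, h₃, h₄⟩
      rw [List.replicate_succ, List.flatten_cons]
      exact reach_append_iff.2 ⟨c₀, h₀, h₁⟩

end SAFA

/-- The data word in which every value of a list is read twice in a row. -/
def doubled {D : Type} (l : List D) : List (Unit × D) :=
  l.flatMap fun d => [((), d), ((), d)]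

theorem doubled_append {D : Type} (l l' : List D) :
    doubled (l ++ l') = doubled l ++ doubled l' :=
  List.flatMap_append

theorem doubled_flatten_replicate {D : Type} (n : ℕ) (l : List D) :
    doubled (List.replicate n l).flatten = (List.replicate n (doubled l)).flatten := by
  induction n with
  | zero => rfl
  | succ n ih => simp only [List.replicate_succ, List.flatten_cons, doubled_append, ih]

theorem mem_starLang_pairLang_iff {D : Type} {w : List (Unit × D)} :
    w ∈ starLang (pairLang D) ↔ ∃ l, w = doubled l := by
  constructor
  · rintro ⟨ws, hws, rfl⟩
    induction ws with
    | nil => exact ⟨[], rfl⟩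
    | cons u ws ih =>
      obtain ⟨l, hl⟩ := ih fun v hv => hws v (List.mem_cons_of_mem _ hv)
      obtain ⟨d, rfl⟩ := hws u List.mem_cons_self
      exact ⟨d :: l, by rw [List.flatten_cons, hl]; rfl⟩
  · rintro ⟨l, rfl⟩
    refine ⟨l.map fun d => [((), d), ((), d)], ?_, List.flatMap_def⟩
    intro u hu
    obtain ⟨d, -, rfl⟩ := List.mem_map.1 hu
    exact ⟨d, rfl⟩

theorem eq_of_doubled_append_eq_doubled {D : Type} {l l' : List D} {x y : D}
    {v : List (Unit × D)} (h : doubled l ++ ((), x) :: ((), y) :: v = doubled l') : x = y := by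
  induction l generalizing l' with
  | nil =>
    cases l' with
    | nil => simp [doubled] at h
    | cons d l' =>
      simp only [doubled, List.flatMap_nil, List.flatMap_cons, List.nil_append,
        List.cons_append, List.cons.injEq, Prod.mk.injEq, true_and] at h
      exact h.1.trans h.2.1.symm
  | cons z l ih =>
    cases l' with
    | nil => simp [doubled] at h
    | cons d l' =>
      simp only [doubled, List.flatMap_cons, List.nil_append,
        List.cons_append, List.cons.injEq] at h
      exact ih h.2.2

theorem SAFA.lang_ne_starLang_pairLang {D : Type} [Infinite D] (M : SAFA Unit D) :
    M.Lang ≠ starLang (pairLang D) := by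
  classical
  intro hM
  obtain ⟨E, hE⟩ := Infinite.exists_subset_card_eq D (Fintype.card (Set M.H) + 1)
  have hw : doubled (List.replicate ((M.missing E M.init).card + 1) E.toList).flatten ∈ M.Lang :=
    hM ▸ mem_starLang_pairLang_iff.2 ⟨_, rfl⟩
  obtain ⟨c, hr, hF⟩ := mem_lang_iff.1 hw
  rw [doubled_flatten_replicate] at hr
  obtain ⟨a, b, c₁, c₂, -, h₁, h₂, h₃, hst⟩ := hr.exists_stable (Nat.lt_succ_self _)
  obtain ⟨d, hd, e, he, hne, hty⟩ := Finset.exists_ne_map_eq_of_card_lt_of_maps_to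
    (s := E) (t := (Finset.univ : Finset (Set M.H))) (f := fun d => {i | d ∈ c₁.2 i})
    (by rw [hE, Finset.card_univ]; omega) (fun _ _ => Finset.mem_univ _)
  obtain ⟨p, q, hpq⟩ := List.append_of_mem (Finset.mem_toList.2 hd)
  have hsplit : doubled E.toList = doubled p ++ ((), d) :: ((), d) :: doubled q := by
    rw [hpq, doubled_append]
    rfl
  rw [hsplit] at h₂
  obtain ⟨c₃, h₁₃, h₂⟩ := reach_append_iff.1 h₂
  obtain ⟨t, c₄, h₃₄, h₂⟩ := reach_cons_iff.1 h₂
  obtain ⟨t', c₅, h₄₅, h₅₂⟩ := reach_cons_iff.1 h₂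
  have h₁₄ : c₁.2 ≤ c₄.2 := h₁₃.le.trans h₃₄.le
  have h₄₂ : c₄.2 ≤ c₂.2 := h₄₅.le.trans h₅₂.le
  have hmem : ∀ x ∈ E, ∀ i, x ∈ c₄.2 i ↔ x ∈ c₁.2 i := fun x hx i =>
    ⟨fun h => hst x hx i (h₄₂ i h), fun h => h₁₄ i h⟩
  have hstep : M.StepVia c₄ t' ((), e) c₅ :=
    h₄₅.replace (fun i h => h₁₄ i (hst d hd i (h₅₂.le i h))) fun i =>
      (hmem d hd i).trans ((Set.ext_iff.1 hty i).trans (hmem e he i).symm)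
  have hacc : doubled (List.replicate a E.toList).flatten ++ (doubled p ++
      ((), d) :: ((), e) :: (doubled q ++ (List.replicate b (doubled E.toList)).flatten)) ∈
      M.Lang := by
    rw [doubled_flatten_replicate]
    exact mem_lang_iff.2 ⟨c, reach_append_iff.2 ⟨c₁, h₁, reach_append_iff.2 ⟨c₃, h₁₃,
      reach_cons_iff.2 ⟨t, c₄, h₃₄, reach_cons_iff.2 ⟨t', c₅, hstep,
        reach_append_iff.2 ⟨c₂, h₅₂, h₃⟩⟩⟩⟩⟩, hF⟩
  rw [hM, mem_starLang_pairLang_iff, ← List.append_assoc, ← doubled_append] at hacc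
  obtain ⟨l, hl⟩ := hacc
  exact hne (eq_of_doubled_append_eq_doubled hl)

/-- The automaton that stores a first value and then reads a stored value. -/
def pairSAFA (D : Type) : SAFA Unit D where
  Q := Fin 3
  fintypeQ := inferInstance
  q0 := 0
  F := {2}
  H := Unit
  fintypeH := inferInstance
  δ := {⟨0, (), .neg (), .ins (), 1⟩, ⟨1, (), .pos (), .noop, 2⟩}

theorem pairSAFA_isDeterministic (D : Type) : (pairSAFA D).IsDeterministic := by
  rintro t₁ t₂ (rfl | rfl) (rfl | rfl) hs -
  · exact ⟨rfl, fun _ => rfl⟩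
  · exact absurd (show (0 : Fin 3) = 1 from hs) (by decide)
  · exact absurd (show (1 : Fin 3) = 0 from hs) (by decide)
  · exact ⟨rfl, fun _ => rfl⟩

theorem pairSAFA_lang (D : Type) : (pairSAFA D).Lang = pairLang D := by
  ext w
  rw [SAFA.mem_lang_iff]
  constructor
  · rintro ⟨c, hr, hF⟩
    rcases w with _ | ⟨⟨⟨⟩, d⟩, w⟩
    · obtain rfl := SAFA.reach_nil_iff.1 hr
      exact absurd (show (0 : Fin 3) = 2 from hF) (by decide)
    obtain ⟨t, ⟨q, s⟩, ⟨ht, hsrc, -, hdst, -, hs⟩, hr₁⟩ := SAFA.reach_cons_iff.1 hr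
    rcases ht with rfl | rfl
    swap
    · exact absurd (show (1 : Fin 3) = 0 from hsrc) (by decide)
    obtain rfl : (1 : Fin 3) = q := hdst
    rcases w with _ | ⟨⟨⟨⟩, e⟩, w⟩
    · obtain rfl := SAFA.reach_nil_iff.1 hr₁
      exact absurd (show (1 : Fin 3) = 2 from hF) (by decide)
    obtain ⟨t, ⟨q, s'⟩, ⟨ht, hsrc, -, hdst, hcond, -⟩, hr₂⟩ := SAFA.reach_cons_iff.1 hr₁
    rcases ht with rfl | rfl
    · exact absurd (show (0 : Fin 3) = 1 from hsrc) (by decide)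
    obtain rfl : (2 : Fin 3) = q := hdst
    obtain rfl : s = fun j => ∅ ∪ {x | j = () ∧ x = d} := hs
    have hed : e = d := hcond.elim False.elim And.right
    rcases w with _ | ⟨x, w⟩
    · exact ⟨d, by rw [hed]⟩
    obtain ⟨t, c', ⟨ht, hsrc, -⟩, -⟩ := SAFA.reach_cons_iff.1 hr₂
    rcases ht with rfl | rfl
    · exact absurd (show (0 : Fin 3) = 2 from hsrc) (by decide)
    · exact absurd (show (1 : Fin 3) = 2 from hsrc) (by decide)
  · rintro ⟨d, rfl⟩
    refine ⟨((2 : Fin 3), fun j => ∅ ∪ {x | j = () ∧ x = d}), ?_, rfl⟩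
    exact SAFA.reach_cons_iff.2 ⟨_, ((1 : Fin 3), fun j => ∅ ∪ {x | j = () ∧ x = d}),
      ⟨Or.inl rfl, rfl, rfl, rfl, id, rfl⟩,
      SAFA.reach_cons_iff.2 ⟨_, ((2 : Fin 3), fun j => ∅ ∪ {x | j = () ∧ x = d}),
        ⟨Or.inr rfl, rfl, rfl, rfl, Or.inr ⟨rfl, rfl⟩, rfl⟩,
        SAFA.reach_nil_iff.2 rfl⟩⟩

/-- SAFA languages are not closed under Kleene star: L1 = {(a,d)(a,d)} is
accepted by a deterministic SAFA, but L1* is not accepted by any SAFA. -/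
theorem safa_not_closed_star {D : Type} [Countable D] [Infinite D] :
    (∃ M : SAFA Unit D, M.IsDeterministic ∧ M.Lang = pairLang D) ∧
    ¬ ∃ M : SAFA Unit D, M.Lang = starLang (pairLang D) := by
  exact ⟨⟨pairSAFA D, pairSAFA_isDeterministic D, pairSAFA_lang D⟩,
    fun ⟨M, hM⟩ => M.lang_ne_starLang_pairLang hM⟩
end

section
/- The class of data languages accepted by deterministic SAFA is closed under complementation: for every DSAFA M over Σ × D there exists a DSAFA M' with L(M') = (Σ × D)* \ L(M). -/
/-- The condition on the set `h` with the given polarity: `true` is membership. -/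
def SafaCond.ofBool {H : Type} (b : Bool) (h : H) : SafaCond H :=
  if b then .pos h else .neg h

/-- The polarity of a condition: `true` for membership, `false` for non-membership. -/
def SafaCond.polarity {H : Type} : SafaCond H → Bool
  | .pos _ => true
  | .neg _ => false

/-- Renaming the sets of an operation. -/
def SafaOp.map {H H' : Type} (f : H → H') : SafaOp H → SafaOp H'
  | .noop => .noop
  | .ins h => .ins (f h)

theorem SafaCond.name_ofBool {H : Type} (b : Bool) (h : H) : (SafaCond.ofBool b h).name = h := by
  cases b <;> rfl

theorem SafaCond.polarity_ofBool {H : Type} (b : Bool) (h : H) :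
    (SafaCond.ofBool b h).polarity = b := by
  cases b <;> rfl

theorem SafaCond.eq_of_name_of_polarity {H : Type} {c c' : SafaCond H}
    (hn : c.name = c'.name) (hp : c.polarity = c'.polarity) : c = c' := by
  cases c <;> cases c' <;> simp_all [SafaCond.name, SafaCond.polarity]

theorem SafaCond.holds_iff {H D : Type} (c : SafaCond H) (d : D) (S : H → Set D) :
    c.holds d S ↔ (c.polarity = true ↔ d ∈ S c.name) := by
  cases c <;> simp [SafaCond.holds, SafaCond.polarity, SafaCond.name]

/-- Set contents over `H` extended by an extra set that is empty. -/
def liftSets {H D : Type} (S : H → Set D) : Option H → Set D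
  | none => ∅
  | some h => S h

theorem SafaOp.apply_map_some {H D : Type} (o : SafaOp H) (d : D) (S : H → Set D) :
    (o.map some).apply d (liftSets S) = liftSets (o.apply d S) := by
  cases o with
  | noop => rfl
  | ins h =>
    funext j
    cases j <;> simp [SafaOp.map, SafaOp.apply, liftSets]

namespace SAFA

variable {A D : Type}

/-- Acceptance of `w` starting from the configuration `c`. -/
def AcceptsFrom (M : SAFA A D) (c : M.Config) (w : List (A × D)) : Prop :=
  ∃ T c', M.ExecFrom c T w c' ∧ c'.1 ∈ M.F

theorem acceptsFrom_nil (M : SAFA A D) (c : M.Config) : M.AcceptsFrom c [] ↔ c.1 ∈ M.F := by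
  constructor
  · rintro ⟨T, c', h, hF⟩
    cases h
    exact hF
  · exact fun h => ⟨[], c, .nil c, h⟩

theorem acceptsFrom_cons (M : SAFA A D) (c : M.Config) (ad : A × D) (w : List (A × D)) :
    M.AcceptsFrom c (ad :: w) ↔ ∃ t c', M.StepVia c t ad c' ∧ M.AcceptsFrom c' w := by
  constructor
  · rintro ⟨T, c', h, hF⟩
    cases h with
    | cons hs he => exact ⟨_, _, hs, _, _, he, hF⟩
  · rintro ⟨t, c', hs, T, c'', he, hF⟩
    exact ⟨t :: T, c'', .cons hs he, hF⟩

theorem IsDeterministic.eq_of_polarity {M : SAFA A D} (hdet : M.IsDeterministic)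
    {t t' : SafaTrans M.Q A M.H} (ht : t ∈ M.δ) (ht' : t' ∈ M.δ) (hs : t.src = t'.src)
    (ha : t.attr = t'.attr) (hp : t.cond.polarity = t'.cond.polarity) : t = t' :=
  have h := hdet t t' ht ht' hs ha
  h.2 (SafaCond.eq_of_name_of_polarity h.1 hp)

open Classical in
/-- The set tested by the complement automaton; `none` if `M` has no transition. -/
noncomputable def complName (M : SAFA A D) (s : Option M.Q) (a : A) : Option M.H :=
  if h : ∃ t ∈ M.δ, some t.src = s ∧ t.attr = a then some h.choose.cond.name else none

open Classical in
/-- The operation and the target of the complement automaton: those of the transition of `M`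
if there is one, and otherwise a move to the sink `none`. -/
noncomputable def complTarget (M : SAFA A D) (s : Option M.Q) (a : A) (b : Bool) :
    SafaOp (Option M.H) × Option M.Q :=
  if h : ∃ t ∈ M.δ, some t.src = s ∧ t.attr = a ∧ t.cond.polarity = b then
    (h.choose.op.map some, some h.choose.dst)
  else (.noop, none)

/-- The unique transition of the complement automaton with given source, attribute and
polarity. -/
noncomputable def complTrans (M : SAFA A D) (s : Option M.Q) (a : A) (b : Bool) :
    SafaTrans (Option M.Q) A (Option M.H) where
  src := s
  attr := a
  cond := .ofBool b (M.complName s a)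
  op := (M.complTarget s a b).1
  dst := (M.complTarget s a b).2

theorem complTrans_name (M : SAFA A D) (s : Option M.Q) (a : A) (b : Bool) :
    (M.complTrans s a b).cond.name = M.complName s a :=
  SafaCond.name_ofBool _ _

theorem complTrans_polarity (M : SAFA A D) (s : Option M.Q) (a : A) (b : Bool) :
    (M.complTrans s a b).cond.polarity = b :=
  SafaCond.polarity_ofBool _ _

theorem complTrans_holds_iff (M : SAFA A D) (s : Option M.Q) (a : A) (b : Bool) (d : D)
    (S : Option M.H → Set D) :
    (M.complTrans s a b).cond.holds d S ↔ (b = true ↔ d ∈ S (M.complName s a)) := by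
  rw [SafaCond.holds_iff, complTrans_name, complTrans_polarity]

/-- The completion of `M` by a sink state, with final and non-final states exchanged. -/
noncomputable def compl (M : SAFA A D) : SAFA A D where
  Q := Option M.Q
  fintypeQ := inferInstance
  q0 := some M.q0
  F := {s | ∀ q ∈ M.F, s ≠ some q}
  H := Option M.H
  fintypeH := inferInstance
  δ := {t | ∃ s a b, t = M.complTrans s a b}

theorem compl_isDeterministic (M : SAFA A D) : M.compl.IsDeterministic := by
  rintro _ _ ⟨s, a, b, rfl⟩ ⟨s', a', b', rfl⟩ hs ha
  obtain rfl : s = s' := hs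
  obtain rfl : a = a' := ha
  refine ⟨(M.complTrans_name s a b).trans (M.complTrans_name s a b').symm, fun h => ?_⟩
  have hb : b = b' := (M.complTrans_polarity s a b).symm.trans
    ((congrArg SafaCond.polarity h).trans (M.complTrans_polarity s a b'))
  exact congrArg (M.complTrans s a) hb

open Classical in
theorem compl_acceptsFrom_cons (M : SAFA A D) (s : Option M.Q) (S : Option M.H → Set D)
    (ad : A × D) (w : List (A × D)) :
    M.compl.AcceptsFrom (s, S) (ad :: w) ↔
      M.compl.AcceptsFrom
        ((M.complTarget s ad.1 (decide (ad.2 ∈ S (M.complName s ad.1)))).2,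
          (M.complTarget s ad.1 (decide (ad.2 ∈ S (M.complName s ad.1)))).1.apply ad.2 S) w := by
  rw [acceptsFrom_cons]
  constructor
  · rintro ⟨_, ⟨s', S'⟩, ⟨⟨s'', a, b, rfl⟩, hs, ha, hd, hc, hS⟩, hw⟩
    obtain rfl : s'' = s := hs
    obtain rfl : a = ad.1 := ha
    obtain rfl : _ = s' := hd
    obtain rfl : S' = _ := hS
    have hb : decide (ad.2 ∈ S (M.complName s'' ad.1)) = b := by
      rw [Bool.eq_iff_iff, decide_eq_true_iff]
      exact ((M.complTrans_holds_iff _ _ _ _ _).1 hc).symm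
    rw [hb]
    exact hw
  · refine fun hw => ⟨M.complTrans s ad.1 _, _, ⟨⟨_, _, _, rfl⟩, rfl, rfl, rfl, ?_, rfl⟩, hw⟩
    exact (M.complTrans_holds_iff _ _ _ _ _).2 decide_eq_true_iff

theorem complTarget_none (M : SAFA A D) (a : A) (b : Bool) :
    M.complTarget none a b = (.noop, none) := by
  simp [complTarget]

theorem compl_acceptsFrom_none (M : SAFA A D) (S : Option M.H → Set D) (w : List (A × D)) :
    M.compl.AcceptsFrom (none, S) w := by
  induction w generalizing S with
  | nil =>
    rw [acceptsFrom_nil]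
    intro q _ h
    cases h
  | cons ad w ih =>
    rw [compl_acceptsFrom_cons, complTarget_none]
    exact ih _

theorem complName_eq {M : SAFA A D} (hdet : M.IsDeterministic) {t : SafaTrans M.Q A M.H}
    (ht : t ∈ M.δ) : M.complName (some t.src) t.attr = some t.cond.name := by
  have h : ∃ t' ∈ M.δ, some t'.src = some t.src ∧ t'.attr = t.attr := ⟨t, ht, rfl, rfl⟩
  rw [complName, dif_pos h]
  obtain ⟨h1, h2, h3⟩ := h.choose_spec
  exact congrArg some (hdet _ _ h1 ht (Option.some.inj h2) h3).1

theorem complTarget_eq {M : SAFA A D} (hdet : M.IsDeterministic) {t : SafaTrans M.Q A M.H}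
    (ht : t ∈ M.δ) :
    M.complTarget (some t.src) t.attr t.cond.polarity = (t.op.map some, some t.dst) := by
  have h : ∃ t' ∈ M.δ, some t'.src = some t.src ∧ t'.attr = t.attr ∧
      t'.cond.polarity = t.cond.polarity := ⟨t, ht, rfl, rfl, rfl⟩
  rw [complTarget, dif_pos h]
  obtain ⟨h1, h2, h3, h4⟩ := h.choose_spec
  rw [hdet.eq_of_polarity h1 ht (Option.some.inj h2) h3 h4]

theorem compl_acceptsFrom_iff {M : SAFA A D} (hdet : M.IsDeterministic) (q : M.Q)
    (S : M.H → Set D) (w : List (A × D)) :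
    M.compl.AcceptsFrom (some q, liftSets S) w ↔ ¬ M.AcceptsFrom (q, S) w := by
  classical
  induction w generalizing q S with
  | nil =>
    rw [acceptsFrom_nil, acceptsFrom_nil]
    constructor
    · exact fun h hq => h q hq rfl
    · rintro h q' hq' heq
      cases heq
      exact h hq'
  | cons ad w ih =>
    rw [compl_acceptsFrom_cons]
    obtain ⟨a, d⟩ := ad
    by_cases h : ∃ t ∈ M.δ, t.src = q ∧ t.attr = a ∧ t.cond.holds d S
    · obtain ⟨t, ht, rfl, rfl, hc⟩ := h
      have hc' := (SafaCond.holds_iff _ _ _).1 hc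
      have hb : decide (d ∈ liftSets S (some t.cond.name)) = t.cond.polarity := by
        rw [Bool.eq_iff_iff, decide_eq_true_iff]
        exact hc'.symm
      simp only [complName_eq hdet ht, hb, complTarget_eq hdet ht, SafaOp.apply_map_some, ih]
      rw [not_iff_not, acceptsFrom_cons]
      constructor
      · exact fun hw => ⟨t, _, ⟨ht, rfl, rfl, rfl, hc, rfl⟩, hw⟩
      · rintro ⟨t', ⟨q', S'⟩, ⟨ht', hs, ha, hd, hh, hS⟩, hw⟩
        have hn := (hdet t' t ht' ht hs ha).1
        have hp : t'.cond.polarity = t.cond.polarity := by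
          rw [SafaCond.holds_iff, hn] at hh
          rw [Bool.eq_iff_iff]
          exact hh.trans hc'.symm
        obtain rfl := hdet.eq_of_polarity ht' ht hs ha hp
        obtain rfl : _ = q' := hd
        obtain rfl : S' = _ := hS
        exact hw
    · have hsink : M.complTarget (some q) a
          (decide (d ∈ liftSets S (M.complName (some q) a))) = (.noop, none) := by
        rw [complTarget, dif_neg]
        rintro ⟨t, ht, hs, rfl, hp⟩
        obtain rfl := Option.some.inj hs
        refine h ⟨t, ht, rfl, rfl, (SafaCond.holds_iff _ _ _).2 ?_⟩
        rw [hp, complName_eq hdet ht, decide_eq_true_iff]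
        rfl
      simp only [hsink]
      refine iff_of_true (M.compl_acceptsFrom_none _ w) ?_
      rw [acceptsFrom_cons]
      rintro ⟨t, _, ⟨ht, hs, ha, -, hh, -⟩, -⟩
      exact h ⟨t, ht, hs, ha, hh⟩

theorem compl_init (M : SAFA A D) : M.compl.init = (some M.q0, liftSets M.init.2) := by
  refine Prod.ext rfl (funext fun j => ?_)
  cases j <;> rfl

end SAFA

/-- deterministic SAFA languages are closed under complementation. -/
theorem dsafa_closed_complement {A D : Type} [Fintype A] [Countable D] [Infinite D]
    (M : SAFA A D) (hdet : M.IsDeterministic) :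
    ∃ M' : SAFA A D, M'.IsDeterministic ∧ M'.Lang = M.Langᶜ := by
  refine ⟨M.compl, M.compl_isDeterministic, Set.ext fun w => ?_⟩
  change M.compl.AcceptsFrom M.compl.init w ↔ ¬ M.AcceptsFrom M.init w
  rw [SAFA.compl_init]
  exact SAFA.compl_acceptsFrom_iff hdet _ _ w
end
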